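/- Let V be a finite set, G a directed acyclic graph on V, and (X_v)_{v∈V} a family of random variables on a probability space (Ω, 𝓕, P), each valued in a nonempty finite type, satisfying the Markov condition with respect to G. Then the global Markov property holds: for all pairwise disjoint subsets A, B, S of V with A and B nonempty, if A and B are d-separated by S in G, then the families (X_a)_{a∈A} and (X_b)_{b∈B} are conditionally independent given the family (X_s)_{s∈S}. -/

import Mathlib

open MeasureTheory ProbabilityTheory Set

namespace CFS

variable {V : Type*}

/-- Parents of `v`: vertices with an edge into `v`. -/
def Pa (E : V → V → Prop) (v : V) : Set V := {u | E u v}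

/-- Children of `v`: vertices with an edge from `v`. -/
def Ch (E : V → V → Prop) (v : V) : Set V := {u | E v u}

/-- Descendants of `v`: vertices reachable from `v` by a nonempty directed path. -/
def Desc (E : V → V → Prop) (v : V) : Set V := {u | Relation.TransGen E v u}

/-- Spouses of `v`: the other parents of the children of `v`. -/
def Sp (E : V → V → Prop) (v : V) : Set V := {u | u ≠ v ∧ ∃ w, E u w ∧ E v w}

/-- The Markov blanket set `mb(v)` in the graph: parents, children and spouses. -/
def mb (E : V → V → Prop) (v : V) : Set V := Pa E v ∪ Ch E v ∪ Sp E v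

/-- The edge relation is acyclic (defines a DAG). -/
def Acyclic (E : V → V → Prop) : Prop := ∀ v, ¬ Relation.TransGen E v v

/-- Adjacency: an edge in either direction. -/
def Adj (E : V → V → Prop) (u v : V) : Prop := E u v ∨ E v u

/-- `f 0, f 1, …, f n` is an undirected path between `i` and `j`:
distinct vertices, consecutive ones adjacent. -/
structure IsUPath (E : V → V → Prop) (i j : V) (n : ℕ) (f : ℕ → V) : Prop where
  pos : 0 < n
  start : f 0 = i
  finish : f n = j
  inj : ∀ s ≤ n, ∀ t ≤ n, f s = f t → s = t
  adj : ∀ t < n, Adj E (f t) (f (t + 1))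

/-- The interior vertex at position `t` of the path `f` is a collider:
both incident edges of the path point into it. -/
def ColliderAt (E : V → V → Prop) (f : ℕ → V) (t : ℕ) : Prop :=
  E (f (t - 1)) (f t) ∧ E (f (t + 1)) (f t)

/-- The path `f 0, …, f n` is blocked by `S`: some interior non-collider lies in `S`,
or some interior collider is such that neither it nor any of its descendants lies in `S`. -/
def Blocked (E : V → V → Prop) (S : Set V) (n : ℕ) (f : ℕ → V) : Prop :=
  ∃ t, 0 < t ∧ t < n ∧
    ((¬ ColliderAt E f t ∧ f t ∈ S) ∨
      (ColliderAt E f t ∧ f t ∉ S ∧ ∀ d ∈ Desc E (f t), d ∉ S))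

/-- `i` and `j` are d-separated by `S`: every undirected path between them is blocked by `S`. -/
def DSep (E : V → V → Prop) (i j : V) (S : Set V) : Prop :=
  ∀ n f, IsUPath E i j n f → Blocked E S n f

/-- The sets `A` and `B` are d-separated by `S`. -/
def DSepSet (E : V → V → Prop) (A B S : Set V) : Prop :=
  ∀ i ∈ A, ∀ j ∈ B, DSep E i j S

variable {Ω Val : Type*} [mΩ : MeasurableSpace Ω] [MeasurableSpace Val]

/-- The σ-algebra generated by the family of random variables `(X v)_{v ∈ A}`. -/
def famSigma (X : V → Ω → Val) (A : Set V) : MeasurableSpace Ω :=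
  ⨆ v ∈ A, MeasurableSpace.comap (X v) inferInstance

theorem famSigma_le {X : V → Ω → Val} (hX : ∀ v, Measurable (X v)) (A : Set V) :
    famSigma X A ≤ mΩ :=
  iSup₂_le fun v _ => (hX v).comap_le

/-- The families `(X a)_{a ∈ A}` and `(X b)_{b ∈ B}` are conditionally independent
given the family `(X s)_{s ∈ S}`. -/
def CondIndepFam [StandardBorelSpace Ω] (X : V → Ω → Val) (hX : ∀ v, Measurable (X v))
    (P : Measure Ω) [IsFiniteMeasure P] (S A B : Set V) : Prop :=
  CondIndep (famSigma X S) (famSigma X A) (famSigma X B) (famSigma_le hX S) P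

/-- The Markov condition: every variable is conditionally independent of its
non-descendants (other than itself and its parents) given its parents. -/
def MarkovCondition [StandardBorelSpace Ω] (E : V → V → Prop) (X : V → Ω → Val)
    (hX : ∀ v, Measurable (X v)) (P : Measure Ω) [IsFiniteMeasure P] : Prop :=
  ∀ v, CondIndepFam X hX P (Pa E v) {v} (univ \ ({v} ∪ Desc E v ∪ Pa E v))

/-- `M ⊆ V \ {C}` is a Markov blanket of `C`: conditioned on `(X m)_{m ∈ M}`,
all other variables are independent of `X C`. -/
def IsMarkovBlanket [StandardBorelSpace Ω] (X : V → Ω → Val) (hX : ∀ v, Measurable (X v))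
    (P : Measure Ω) [IsFiniteMeasure P] (C : V) (M : Set V) : Prop :=
  C ∉ M ∧ CondIndepFam X hX P M {C} (univ \ (M ∪ {C}))

/-- A Markov boundary of `C` is a Markov blanket of `C` no proper subset of which
is a Markov blanket of `C`. -/
def IsMarkovBoundary [StandardBorelSpace Ω] (X : V → Ω → Val) (hX : ∀ v, Measurable (X v))
    (P : Measure Ω) [IsFiniteMeasure P] (C : V) (M : Set V) : Prop :=
  IsMarkovBlanket X hX P C M ∧ ∀ M' ⊂ M, ¬ IsMarkovBlanket X hX P C M'

/-- Faithfulness: conditional independence holds exactly when d-separation holds. -/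
def Faithful [StandardBorelSpace Ω] (E : V → V → Prop) (X : V → Ω → Val)
    (hX : ∀ v, Measurable (X v)) (P : Measure Ω) [IsFiniteMeasure P] : Prop :=
  ∀ A B S : Set V, A.Nonempty → B.Nonempty →
    Disjoint A B → Disjoint A S → Disjoint B S →
    (CondIndepFam X hX P S A B ↔ DSepSet E A B S)

/-- `v` is strongly relevant to `C`: `X C` and `X v` are not conditionally independent
given all the remaining variables. -/
def StronglyRelevant [StandardBorelSpace Ω] (X : V → Ω → Val) (hX : ∀ v, Measurable (X v))
    (P : Measure Ω) [IsFiniteMeasure P] (C v : V) : Prop :=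
  ¬ CondIndepFam X hX P (univ \ {C, v}) {C} {v}

end CFS

open CFS

section Prob

lemma gm_forward {Ω : Type*} {m' m₁ m₂ : MeasurableSpace Ω}
    {mΩ : MeasurableSpace Ω} [StandardBorelSpace Ω] (hm' : m' ≤ mΩ) (hm₁ : m₁ ≤ mΩ) (hm₂ : m₂ ≤ mΩ)
    (μ : Measure Ω) [IsFiniteMeasure μ] (h : CondIndep m' m₁ m₂ hm' μ)
    (t : Set Ω) (ht : MeasurableSet[m₁] t) :
    (μ⟦t | m₂ ⊔ m'⟧) =ᵐ[μ] (μ⟦t | m'⟧) := by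
  rw [condIndep_iff m' m₁ m₂ hm' hm₁ hm₂ μ] at h
  have htm : MeasurableSet t := hm₁ t ht
  have hf : Integrable (t.indicator (fun _ => (1 : ℝ))) μ :=
    (integrable_const (1 : ℝ)).indicator htm
  have hsup : m₂ ⊔ m' ≤ mΩ := sup_le hm₂ hm'
  set f : Ω → ℝ := t.indicator (fun _ => (1 : ℝ)) with hfdef
  set g : Ω → ℝ := μ[f | m'] with hgdef
  have hg : Integrable g μ := integrable_condExp
  symm
  have key : ∀ s2 s', MeasurableSet[m₂] s2 → MeasurableSet[m'] s' →
      ∫ x in s' ∩ s2, g x ∂μ = ∫ x in s' ∩ s2, f x ∂μ := by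
    intro s2 s' hs2 hs'
    have hs2m := hm₂ s2 hs2
    have hi2 : Integrable (s2.indicator (fun _ => (1 : ℝ))) μ :=
      (integrable_const (1 : ℝ)).indicator hs2m
    have e0 : g * s2.indicator (fun _ => (1 : ℝ)) = s2.indicator g := by
      ext x; by_cases hx : x ∈ s2 <;> simp [hx]
    have hig : Integrable (g * s2.indicator (fun _ => (1 : ℝ))) μ := by
      rw [e0]; exact hg.indicator hs2m
    have e1 : μ[g * s2.indicator (fun _ => (1 : ℝ)) | m'] =ᵐ[μ] g * (μ⟦s2 | m'⟧) :=
      condExp_mul_of_stronglyMeasurable_left stronglyMeasurable_condExp hig hi2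
    have e2 := h t s2 ht hs2
    have hits : Integrable ((t ∩ s2).indicator (fun _ => (1 : ℝ))) μ :=
      (integrable_const (1 : ℝ)).indicator (htm.inter hs2m)
    calc ∫ x in s' ∩ s2, g x ∂μ = ∫ x in s', s2.indicator g x ∂μ :=
          (setIntegral_indicator hs2m).symm
      _ = ∫ x in s', (μ[g * s2.indicator (fun _ => (1 : ℝ)) | m']) x ∂μ := by
          rw [setIntegral_condExp hm' hig hs', e0]
      _ = ∫ x in s', (μ⟦t ∩ s2 | m'⟧) x ∂μ := by
          apply setIntegral_congr_ae (hm' s' hs')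
          filter_upwards [e1, e2] with x h1 h2 _
          rw [h1, h2]
      _ = ∫ x in s', (t ∩ s2).indicator (fun _ => (1 : ℝ)) x ∂μ :=
          setIntegral_condExp hm' hits hs'
      _ = ∫ x in s', s2.indicator f x ∂μ := by
          congr 1; ext x
          by_cases hx : x ∈ s2 <;> by_cases hy : x ∈ t <;> simp [hx, hy, hfdef]
      _ = _ := setIntegral_indicator hs2m
  have hgen : m₂ ⊔ m' = MeasurableSpace.generateFrom
      {u | ∃ s2 s', MeasurableSet[m₂] s2 ∧ MeasurableSet[m'] s' ∧ u = s' ∩ s2} := by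
    apply le_antisymm
    · apply sup_le
      · intro s hs
        exact MeasurableSpace.measurableSet_generateFrom
          ⟨s, univ, hs, MeasurableSet.univ, by simp⟩
      · intro s hs
        exact MeasurableSpace.measurableSet_generateFrom
          ⟨univ, s, MeasurableSet.univ, hs, by simp⟩
    · apply MeasurableSpace.generateFrom_le
      rintro u ⟨s2, s', h2, h', rfl⟩
      exact MeasurableSet.inter ((le_sup_right : m' ≤ m₂ ⊔ m') _ h')
        ((le_sup_left : m₂ ≤ m₂ ⊔ m') _ h2)
  have hpi : IsPiSystem
      {u | ∃ s2 s', MeasurableSet[m₂] s2 ∧ MeasurableSet[m'] s' ∧ u = s' ∩ s2} := by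
    rintro _ ⟨a, b, ha, hb, rfl⟩ _ ⟨c, d, hc, hd, rfl⟩ _
    exact ⟨a ∩ c, b ∩ d, ha.inter hc, hb.inter hd, Set.inter_inter_inter_comm _ _ _ _⟩
  have htot : ∫ x, g x ∂μ = ∫ x, f x ∂μ := by
    simpa using key univ univ MeasurableSet.univ MeasurableSet.univ
  have hgs : StronglyMeasurable[m'] g := stronglyMeasurable_condExp
  have hgs2 : StronglyMeasurable[m₂ ⊔ m'] g := hgs.mono le_sup_right
  refine ae_eq_condExp_of_forall_setIntegral_eq hsup hf (fun _ _ _ => hg.integrableOn) ?_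
    hgs2.aestronglyMeasurable
  intro s hs _
  induction s, hs using MeasurableSpace.induction_on_inter hgen hpi with
  | empty => simp
  | basic u hu =>
    obtain ⟨s2, s', h2, h', rfl⟩ := hu
    exact key s2 s' h2 h'
  | compl u hu ih =>
    rw [setIntegral_compl (hsup u hu) hg, setIntegral_compl (hsup u hu) hf, htot,
      ih (measure_lt_top _ _)]
  | iUnion F hd hF ih =>
    rw [integral_iUnion (fun i => hsup _ (hF i)) hd hg.integrableOn,
      integral_iUnion (fun i => hsup _ (hF i)) hd hf.integrableOn]
    exact tsum_congr fun i => ih i (measure_lt_top _ _)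

lemma gm_backward {Ω : Type*} {m' m₁ m₂ : MeasurableSpace Ω}
    {mΩ : MeasurableSpace Ω} [StandardBorelSpace Ω] (hm' : m' ≤ mΩ) (hm₁ : m₁ ≤ mΩ) (hm₂ : m₂ ≤ mΩ)
    (μ : Measure Ω) [IsFiniteMeasure μ]
    (h : ∀ t, MeasurableSet[m₁] t → (μ⟦t | m₂ ⊔ m'⟧) =ᵐ[μ] (μ⟦t | m'⟧)) :
    CondIndep m' m₁ m₂ hm' μ := by
  rw [condIndep_iff m' m₁ m₂ hm' hm₁ hm₂ μ]
  intro t s ht hs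
  have hsup : m₂ ⊔ m' ≤ mΩ := sup_le hm₂ hm'
  have htm : MeasurableSet t := hm₁ t ht
  have hsm := hm₂ s hs
  have hf : Integrable (t.indicator (fun _ => (1 : ℝ))) μ :=
    (integrable_const (1 : ℝ)).indicator htm
  have hi2 : Integrable (s.indicator (fun _ => (1 : ℝ))) μ :=
    (integrable_const (1 : ℝ)).indicator hsm
  have e0 : (t ∩ s).indicator (fun _ => (1 : ℝ)) = s.indicator (t.indicator (fun _ => (1 : ℝ))) := by
    ext x
    by_cases hx : x ∈ s <;> by_cases hy : x ∈ t <;> simp [hx, hy]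
  have e1 : (μ⟦t ∩ s | m₂ ⊔ m'⟧) =ᵐ[μ] s.indicator (μ⟦t | m₂ ⊔ m'⟧) := by
    rw [e0]
    exact condExp_indicator hf ((le_sup_left : m₂ ≤ m₂ ⊔ m') _ hs)
  have e2 : (μ⟦t ∩ s | m₂ ⊔ m'⟧) =ᵐ[μ] (μ⟦t | m'⟧) * s.indicator (fun _ => (1 : ℝ)) := by
    filter_upwards [e1, h t ht] with x h1 h2
    rw [h1]
    by_cases hx : x ∈ s <;> simp [hx, h2]
  have hig : Integrable ((μ⟦t | m'⟧) * s.indicator (fun _ => (1 : ℝ))) μ :=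
    integrable_condExp.congr e2
  calc (μ⟦t ∩ s | m'⟧) =ᵐ[μ] μ[(μ⟦t ∩ s | m₂ ⊔ m'⟧) | m'] :=
        (condExp_condExp_of_le le_sup_right hsup).symm
    _ =ᵐ[μ] μ[(μ⟦t | m'⟧) * s.indicator (fun _ => (1 : ℝ)) | m'] := condExp_congr_ae e2
    _ =ᵐ[μ] _ := condExp_mul_of_stronglyMeasurable_left stronglyMeasurable_condExp hig hi2

variable {V Ω Val : Type*} [mΩ : MeasurableSpace Ω] [StandardBorelSpace Ω] [MeasurableSpace Val]
  {X : V → Ω → Val} {hX : ∀ v, Measurable (X v)} {P : Measure Ω} [IsFiniteMeasure P]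

lemma gm_famSigma_mono {A B : Set V} (h : A ⊆ B) : famSigma X A ≤ famSigma X B :=
  biSup_mono h

lemma gm_famSigma_union (A B : Set V) :
    famSigma X (A ∪ B) = famSigma X A ⊔ famSigma X B := iSup_union

lemma gm_iff (S A B : Set V) : CondIndepFam X hX P S A B ↔
    ∀ t, MeasurableSet[famSigma X A] t →
      (P⟦t | famSigma X (B ∪ S)⟧) =ᵐ[P] (P⟦t | famSigma X S⟧) := by
  rw [gm_famSigma_union]
  exact ⟨fun h t ht => gm_forward (famSigma_le hX S) (famSigma_le hX A) (famSigma_le hX B) P h t ht,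
    fun h => gm_backward (famSigma_le hX S) (famSigma_le hX A) (famSigma_le hX B) P h⟩

lemma gm_tower {t : Set Ω} {S T U : Set V} (hX : ∀ v, Measurable (X v))
    (hST : S ⊆ T) (hTU : T ⊆ U)
    (h : (P⟦t | famSigma X U⟧) =ᵐ[P] (P⟦t | famSigma X S⟧)) :
    (P⟦t | famSigma X T⟧) =ᵐ[P] (P⟦t | famSigma X S⟧) := by
  have h1 : P[(P⟦t | famSigma X U⟧) | famSigma X T] =ᵐ[P] (P⟦t | famSigma X T⟧) :=
    condExp_condExp_of_le (gm_famSigma_mono hTU) (famSigma_le hX U)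
  refine h1.symm.trans ((condExp_congr_ae h).trans ?_)
  rw [condExp_of_stronglyMeasurable (famSigma_le hX T)
    (stronglyMeasurable_condExp.mono (gm_famSigma_mono hST)) integrable_condExp]

lemma gm_symm {S A B : Set V} (h : CondIndepFam X hX P S A B) : CondIndepFam X hX P S B A :=
  CondIndep.symm h

lemma gm_mono {S A B A' B' : Set V} (h : CondIndepFam X hX P S A B) (hA : A' ⊆ A) (hB : B' ⊆ B) :
    CondIndepFam X hX P S A' B' :=
  condIndep_of_condIndep_of_le_left
    (condIndep_of_condIndep_of_le_right h (gm_famSigma_mono hB)) (gm_famSigma_mono hA)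

lemma gm_contraction {S A B C : Set V} (h1 : CondIndepFam X hX P S A B)
    (h2 : CondIndepFam X hX P (B ∪ S) A C) : CondIndepFam X hX P S A (B ∪ C) := by
  rw [gm_iff] at *
  intro t ht
  have e : B ∪ C ∪ S = C ∪ (B ∪ S) := by ext; simp; tauto
  rw [e]
  exact (h2 t ht).trans (h1 t ht)

lemma gm_weakUnion {S A B C : Set V} (h : CondIndepFam X hX P S A (B ∪ C)) :
    CondIndepFam X hX P (C ∪ S) A B := by
  rw [gm_iff] at *
  intro t ht
  rw [← union_assoc]
  exact (h t ht).trans (gm_tower hX subset_union_right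
    (by intro x; simp; tauto) (h t ht)).symm

lemma gm_local {E : V → V → Prop} (hM : MarkovCondition E X hX P)
    {v : V} {T B : Set V} (hT : Pa E v ⊆ T) (h1 : v ∉ T ∪ B)
    (h2 : ∀ w ∈ T ∪ B, ¬ Relation.TransGen E v w) : CondIndepFam X hX P T {v} B := by
  have h := hM v
  rw [gm_iff] at *
  intro t ht
  have hsub : B ∪ T ⊆ (univ \ ({v} ∪ Desc E v ∪ Pa E v)) ∪ Pa E v := by
    intro w hw
    by_cases hp : w ∈ Pa E v
    · exact Or.inr hp
    · refine Or.inl ⟨trivial, ?_⟩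
      rw [union_comm] at hw
      rintro ((h | h) | h)
      · exact h1 (h ▸ hw)
      · exact h2 w hw h
      · exact hp h
  exact (gm_tower hX (hT.trans subset_union_right) hsub (h t ht)).trans
    (gm_tower hX hT (subset_union_right.trans hsub) (h t ht)).symm

end Prob

section Graph

/-- An ancestral set split into `A`, `B`, `S` without moral edges between `A` and `B`. -/
structure GMSplit {V : Type*} (E : V → V → Prop) (A B S : Set V) : Prop where
  anc : ∀ v ∈ A ∪ B ∪ S, ∀ u, E u v → u ∈ A ∪ B ∪ S
  dAB : ∀ v ∈ A, v ∉ B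
  dAS : ∀ v ∈ A, v ∉ S
  dBS : ∀ v ∈ B, v ∉ S
  noab : ∀ a ∈ A, ∀ b ∈ B, ¬ E a b
  noba : ∀ a ∈ A, ∀ b ∈ B, ¬ E b a
  nomar : ∀ a ∈ A, ∀ b ∈ B, ∀ w ∈ A ∪ B ∪ S, E a w → ¬ E b w

lemma GMSplit.symm {V : Type*} {E : V → V → Prop} {A B S : Set V} (h : GMSplit E A B S) :
    GMSplit E B A S where
  anc := by rw [union_comm B A]; exact h.anc
  dAB := fun v hv hv' => h.dAB v hv' hv
  dAS := h.dBS
  dBS := h.dAS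
  noab := fun a ha b hb => h.noba b hb a ha
  noba := fun a ha b hb => h.noab b hb a ha
  nomar := by
    rw [union_comm B A]
    exact fun a ha b hb w hw h1 h2 => h.nomar b hb a ha w hw h2 h1

lemma gm_split {V Ω Val : Type*} [Finite V] [MeasurableSpace Ω] [StandardBorelSpace Ω]
    [MeasurableSpace Val] {E : V → V → Prop} (hE : Acyclic E)
    {X : V → Ω → Val} {hX : ∀ v, Measurable (X v)} {P : Measure Ω} [IsFiniteMeasure P]
    (hM : MarkovCondition E X hX P) (n : ℕ) :
    ∀ A B S : Set V, GMSplit E A B S → (A ∪ B ∪ S).ncard = n → CondIndepFam X hX P S A B := by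
  induction n with
  | zero =>
    intro A B S _ hc
    have he : A ∪ B ∪ S = ∅ := (Set.ncard_eq_zero (Set.toFinite _)).1 hc
    have hA : A = ∅ := by
      apply Set.eq_empty_of_subset_empty; rw [← he]; intro x hx; exact Or.inl (Or.inl hx)
    subst hA
    have : famSigma X (∅ : Set V) = ⊥ := by simp [famSigma]
    unfold CondIndepFam
    rw [this]
    exact condIndep_bot_left _
  | succ n ih =>
    intro A B S hG hc
    have hne : (A ∪ B ∪ S).Nonempty := by
      rw [← Set.ncard_pos (Set.toFinite _)]; omega
    -- a sink of the ancestral set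
    obtain ⟨v, hv, hsink⟩ : ∃ v ∈ A ∪ B ∪ S, ∀ w ∈ A ∪ B ∪ S, ¬ Relation.TransGen E v w := by
      haveI : Std.Irrefl (fun x y => Relation.TransGen E y x) := ⟨fun a h => hE a h⟩
      haveI : IsTrans V (fun x y => Relation.TransGen E y x) :=
        ⟨fun a b c h1 h2 => h2.trans h1⟩
      have wf : WellFounded (fun x y => Relation.TransGen E y x) :=
        Finite.wellFounded_of_trans_of_irrefl _
      obtain ⟨v, hv, h⟩ := wf.has_min _ hne
      exact ⟨v, hv, fun w hw => h w hw⟩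
    have caseA : ∀ A B : Set V, GMSplit E A B S → (A ∪ B ∪ S).ncard = n + 1 → v ∈ A →
        (∀ w ∈ A ∪ B ∪ S, ¬ Relation.TransGen E v w) → CondIndepFam X hX P S A B := by
      intro A B hG hc hvA hsink
      have hvB := hG.dAB v hvA
      have hvS := hG.dAS v hvA
      have e : (A \ {v}) ∪ B ∪ S = (A ∪ B ∪ S) \ {v} := by
        ext x; by_cases hx : x = v
        · subst hx; simp [hvB, hvS]
        · simp [hx]
      have hG' : GMSplit E (A \ {v}) B S := by
        refine ⟨?_, fun x hx => hG.dAB x hx.1, fun x hx => hG.dAS x hx.1, hG.dBS,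
          fun a ha => hG.noab a ha.1, fun a ha => hG.noba a ha.1, ?_⟩
        · rw [e]
          rintro x ⟨hx, hxv⟩ u hu
          refine ⟨hG.anc x hx u hu, ?_⟩
          rintro rfl
          exact hsink x hx (.single hu)
        · rw [e]
          intro a ha b hb w hw
          exact hG.nomar a ha.1 b hb w hw.1
      have h1 := ih _ _ _ hG' (by
        rw [e, Set.ncard_sdiff_singleton_of_mem (show v ∈ A ∪ B ∪ S from Or.inl (Or.inl hvA)), hc]; rfl)
      have h2 : CondIndepFam X hX P ((A \ {v}) ∪ S) {v} B := by
        refine gm_local hM ?_ ?_ ?_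
        · intro u hu
          have huv : u ≠ v := by rintro rfl; exact hE u (.single hu)
          rcases hG.anc v (Or.inl (Or.inl hvA)) u hu with (h | h) | h
          · exact Or.inl ⟨h, huv⟩
          · exact absurd hu (hG.noba v hvA u h)
          · exact Or.inr h
        · simp [hvB, hvS]
        · intro w hw
          apply hsink w
          simp at hw ⊢; tauto
      have h3 := gm_contraction (gm_symm h1) (gm_symm h2)
      refine gm_symm (gm_mono h3 subset_rfl ?_)
      intro x hx; by_cases h : x = v <;> simp [h, hx]
    have caseS : ∀ A B : Set V, GMSplit E A B S → (A ∪ B ∪ S).ncard = n + 1 → v ∈ S →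
        (∀ w ∈ A ∪ B ∪ S, ¬ Relation.TransGen E v w) → (∀ b ∈ B, ¬ E b v) →
        CondIndepFam X hX P S A B := by
      intro A B hG hc hvS hsink hpa
      have hvA : v ∉ A := fun h => hG.dAS v h hvS
      have hvB : v ∉ B := fun h => hG.dBS v h hvS
      have e : A ∪ B ∪ (S \ {v}) = (A ∪ B ∪ S) \ {v} := by
        ext x; by_cases hx : x = v
        · subst hx; simp [hvB, hvA]
        · simp [hx]
      have hG' : GMSplit E A B (S \ {v}) := by
        refine ⟨?_, hG.dAB, fun x hx h => hG.dAS x hx h.1, fun x hx h => hG.dBS x hx h.1,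
          hG.noab, hG.noba, ?_⟩
        · rw [e]
          rintro x ⟨hx, hxv⟩ u hu
          refine ⟨hG.anc x hx u hu, ?_⟩
          rintro rfl
          exact hsink x hx (.single hu)
        · rw [e]
          intro a ha b hb w hw
          exact hG.nomar a ha b hb w hw.1
      have h1 := ih _ _ _ hG' (by
        rw [e, Set.ncard_sdiff_singleton_of_mem (show v ∈ A ∪ B ∪ S from Or.inr hvS), hc]; rfl)
      have h2 : CondIndepFam X hX P (A ∪ (S \ {v})) {v} B := by
        refine gm_local hM ?_ ?_ ?_
        · intro u hu
          have huv : u ≠ v := by rintro rfl; exact hE u (.single hu)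
          rcases hG.anc v (Or.inr hvS) u hu with (h | h) | h
          · exact Or.inl h
          · exact absurd hu (hpa u h)
          · exact Or.inr ⟨h, huv⟩
        · simp [hvB, hvA]
        · intro w hw
          apply hsink w
          simp at hw ⊢; tauto
      have h3 := gm_weakUnion (gm_contraction (gm_symm h1) (gm_symm h2))
      have e2 : {v} ∪ (S \ {v}) = S := by
        ext x; by_cases h : x = v <;> simp [h, hvS]
      rw [e2] at h3
      exact gm_symm h3
    have hc' : (B ∪ A ∪ S).ncard = n + 1 := by rw [union_comm B A]; exact hc
    have hsink' : ∀ w ∈ B ∪ A ∪ S, ¬ Relation.TransGen E v w := by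
      rw [union_comm B A]; exact hsink
    rcases hv with (hv | hv) | hv
    · exact caseA A B hG hc hv hsink
    · exact gm_symm (caseA B A hG.symm hc' hv hsink')
    · by_cases hb : ∀ b ∈ B, ¬ E b v
      · exact caseS A B hG hc hv hsink hb
      · push Not at hb
        obtain ⟨b, hb, hbv⟩ := hb
        exact gm_symm (caseS B A hG.symm hc' hv hsink'
          (fun a ha hav => hG.nomar a ha b hb v (Or.inr hv) hav hbv))

/-- `v` is in `S` or has a descendant in `S`. -/
def GMAn {V : Type*} (E : V → V → Prop) (S : Set V) (v : V) : Prop :=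
  ∃ s ∈ S, Relation.ReflTransGen E v s

/-- Reachability along active walks (`true`: last edge points out of the vertex). -/
inductive GMReach {V : Type*} (E : V → V → Prop) (S A : Set V) : V → Bool → Prop
  | start (a : V) : a ∈ A → GMReach E S A a true
  | upUp (v p : V) : GMReach E S A v true → v ∉ S → E p v → GMReach E S A p true
  | upDown (v c : V) : GMReach E S A v true → v ∉ S → E v c → GMReach E S A c false
  | downDown (v c : V) : GMReach E S A v false → v ∉ S → E v c → GMReach E S A c false
  | downUp (v p : V) : GMReach E S A v false → GMAn E S v → E p v → GMReach E S A p true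

/-- Active walks. -/
structure GMAct {V : Type*} (E : V → V → Prop) (S : Set V) (n : ℕ) (f : ℕ → V) : Prop where
  adj : ∀ t < n, Adj E (f t) (f (t + 1))
  col : ∀ t, 0 < t → t < n → ColliderAt E f t → GMAn E S (f t)
  ncol : ∀ t, 0 < t → t < n → ¬ ColliderAt E f t → f t ∉ S

variable {V : Type*} {E : V → V → Prop} {S A B : Set V}

lemma GMAn.head {u v : V} (h : GMAn E S v) (huv : E u v) : GMAn E S u := by
  obtain ⟨s, hs, h⟩ := h
  exact ⟨s, hs, .head huv h⟩

lemma GMAn.self {u : V} (h : u ∈ S) : GMAn E S u := ⟨u, h, .refl⟩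

lemma gm_ext {n : ℕ} {f : ℕ → V} (h : GMAct E S n f) (u : V) (hadj : Adj E (f n) u)
    (h1 : 0 < n → E (f (n - 1)) (f n) → E u (f n) → GMAn E S (f n))
    (h2 : 0 < n → ¬ (E (f (n - 1)) (f n) ∧ E u (f n)) → f n ∉ S) :
    ∃ g : ℕ → V, GMAct E S (n + 1) g ∧ g 0 = f 0 ∧ g (n + 1) = u ∧ g n = f n := by
  have hcolt : ∀ t, t < n → (ColliderAt E (fun t => if t ≤ n then f t else u) t ↔
      ColliderAt E f t) := by
    intro t ht
    have a1 : t - 1 ≤ n := by omega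
    have a2 : t ≤ n := by omega
    have a3 : t + 1 ≤ n := by omega
    simp only [ColliderAt, a1, a2, a3, if_true]
  have hcoln : ColliderAt E (fun t => if t ≤ n then f t else u) n ↔
      (E (f (n - 1)) (f n) ∧ E u (f n)) := by
    simp [ColliderAt]
  refine ⟨fun t => if t ≤ n then f t else u, ⟨?_, ?_, ?_⟩, by simp, by simp, by simp⟩
  · intro t ht
    by_cases htn : t = n
    · subst htn; simpa using hadj
    · have a2 : t ≤ n := by omega
      have a3 : t + 1 ≤ n := by omega
      simp only [a2, a3, if_true]
      exact h.adj t (by omega)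
  · intro t h0 ht hc
    have a2 : t ≤ n := by omega
    simp only [a2, if_true]
    by_cases htn : t = n
    · subst htn
      rw [hcoln] at hc
      exact h1 h0 hc.1 hc.2
    · rw [hcolt t (by omega)] at hc
      exact h.col t h0 (by omega) hc
  · intro t h0 ht hc
    have a2 : t ≤ n := by omega
    simp only [a2, if_true]
    by_cases htn : t = n
    · subst htn
      rw [hcoln] at hc
      exact h2 h0 hc
    · rw [hcolt t (by omega)] at hc
      exact h.ncol t h0 (by omega) hc

lemma gm_asymm (hE : Acyclic E) {u v : V} (h : E u v) : ¬ E v u :=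
  fun h' => hE u ((Relation.TransGen.single h).tail h')

lemma gm_reach_walk (hE : Acyclic E) {v : V} {d : Bool} (h : GMReach E S A v d) :
    ∃ n f, GMAct E S n f ∧ f 0 ∈ A ∧ f n = v ∧
      (d = true → n = 0 ∨ E (f n) (f (n - 1))) ∧ (d = false → 0 < n ∧ E (f (n - 1)) (f n)) := by
  induction h with
  | start a ha =>
    exact ⟨0, fun _ => a, ⟨by simp, by intro t _ h; omega, by intro t _ h; omega⟩, ha, rfl,
      by simp, by simp⟩
  | upUp v p _ hS hp ih =>
    obtain ⟨n, f, hf, h0, rfl, hd, -⟩ := ih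
    obtain ⟨g, hg, g0, g1, g2⟩ := gm_ext hf p (Or.inr hp)
      (fun hn h _ => by
        rcases hd rfl with h' | h'
        · omega
        · exact absurd h' (gm_asymm hE h)) (fun _ _ => hS)
    refine ⟨n + 1, g, hg, g0 ▸ h0, g1, ?_, by simp⟩
    intro _; right; simpa [g1, g2] using hp
  | upDown v p _ hS hp ih =>
    obtain ⟨n, f, hf, h0, rfl, hd, -⟩ := ih
    obtain ⟨g, hg, g0, g1, g2⟩ := gm_ext hf p (Or.inl hp)
      (fun hn h _ => by
        rcases hd rfl with h' | h'
        · omega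
        · exact absurd h' (gm_asymm hE h)) (fun _ _ => hS)
    refine ⟨n + 1, g, hg, g0 ▸ h0, g1, by simp, ?_⟩
    intro _; simpa [g1, g2] using hp
  | downDown v p _ hS hp ih =>
    obtain ⟨n, f, hf, h0, rfl, -, hd⟩ := ih
    obtain ⟨g, hg, g0, g1, g2⟩ := gm_ext hf p (Or.inl hp)
      (fun hn _ h => absurd h (gm_asymm hE hp)) (fun _ _ => hS)
    refine ⟨n + 1, g, hg, g0 ▸ h0, g1, by simp, ?_⟩
    intro _; simpa [g1, g2] using hp
  | downUp v p _ hS hp ih =>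
    obtain ⟨n, f, hf, h0, rfl, -, hd⟩ := ih
    obtain ⟨g, hg, g0, g1, g2⟩ := gm_ext hf p (Or.inr hp)
      (fun _ _ _ => hS) (fun _ h => absurd ⟨(hd rfl).2, hp⟩ h)
    refine ⟨n + 1, g, hg, g0 ▸ h0, g1, ?_, by simp⟩
    intro _; right; simpa [g1, g2] using hp

lemma gm_first_collider (hE : Acyclic E) {n : ℕ} {f : ℕ → V} (h : GMAct E S n f)
    (k : ℕ) : ∀ s t, t = s + k + 1 → t ≤ n → E (f s) (f (s + 1)) → E (f t) (f (t - 1)) →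
      GMAn E S (f s) := by
  induction k with
  | zero =>
    rintro s t rfl _ h1 h2
    exact absurd h2 (gm_asymm hE h1)
  | succ k ih =>
    intro s t ht htn h1 h2
    refine GMAn.head ?_ h1
    rcases h.adj (s + 1) (by omega) with h3 | h3
    · exact ih (s + 1) t (by omega) htn h3 h2
    · exact h.col (s + 1) (by omega) (by omega) ⟨h1, h3⟩

lemma gm_shortcut (hE : Acyclic E) {n : ℕ} {f : ℕ → V} (h : GMAct E S n f)
    {s t : ℕ} (hst : s < t) (htn : t ≤ n) (hf : f s = f t) :
    ∃ g : ℕ → V, GMAct E S (n - (t - s)) g ∧ g 0 = f 0 ∧ g (n - (t - s)) = f n := by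
  obtain ⟨k, rfl⟩ : ∃ k, t = s + k := ⟨t - s, by omega⟩
  have hk : s + k - s = k := by omega
  rw [hk]
  set g : ℕ → V := fun i => if i ≤ s then f i else f (i + k) with hg
  have gl : ∀ i, i ≤ s → g i = f i := fun i hi => by simp [hg, hi]
  have gr : ∀ i, s ≤ i → g i = f (i + k) := by
    intro i hi
    by_cases h' : i = s
    · subst h'; simp [hg, hf]
    · have : ¬ i ≤ s := by omega
      simp [hg, this]
  have hcl : ∀ i, i < s → (ColliderAt E g i ↔ ColliderAt E f i) := by
    intro i hi
    simp only [ColliderAt]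
    rw [gl i (by omega), gl (i - 1) (by omega), gl (i + 1) (by omega)]
  have hcr : ∀ i, s < i → (ColliderAt E g i ↔ ColliderAt E f (i + k)) := by
    intro i hi
    simp only [ColliderAt]
    rw [gr i (by omega), gr (i - 1) (by omega), gr (i + 1) (by omega)]
    have e1 : i - 1 + k = i + k - 1 := by omega
    have e2 : i + 1 + k = i + k + 1 := by omega
    rw [e1, e2]
  have hcm : ColliderAt E g s ↔ (E (f (s - 1)) (f s) ∧ E (f (s + k + 1)) (f (s + k))) := by
    simp only [ColliderAt]
    rw [gl s le_rfl, gl (s - 1) (by omega), gr (s + 1) (by omega), hf]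
    have e2 : s + 1 + k = s + k + 1 := by omega
    rw [e2]
  refine ⟨g, ⟨?_, ?_, ?_⟩, gl 0 (by omega), ?_⟩
  · intro i hi
    by_cases his : i < s
    · rw [gl i (by omega), gl (i + 1) (by omega)]
      exact h.adj i (by omega)
    · rw [gr i (by omega), gr (i + 1) (by omega)]
      have := h.adj (i + k) (by omega)
      have e2 : i + 1 + k = i + k + 1 := by omega
      rwa [e2]
  · intro i h0 hi hc
    rcases lt_trichotomy i s with his | rfl | his
    · rw [gl i (by omega)]
      exact h.col i h0 (by omega) ((hcl i his).1 hc)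
    · rw [gl i le_rfl]
      obtain ⟨c1, c2⟩ := hcm.1 hc
      rcases h.adj i (by omega) with h3 | h3
      · have h4 := h.adj (i + k - 1) (by omega)
        have e3 : i + k - 1 + 1 = i + k := by omega
        rw [e3] at h4
        rcases h4 with h4 | h4
        · rw [hf]
          exact h.col (i + k) (by omega) (by omega) ⟨h4, c2⟩
        · exact gm_first_collider hE h (k - 1) i (i + k) (by omega) htn h3 h4
      · exact h.col i h0 (by omega) ⟨c1, h3⟩
    · rw [gr i (by omega)]
      exact h.col (i + k) (by omega) (by omega) ((hcr i his).1 hc)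
  · intro i h0 hi hc
    rcases lt_trichotomy i s with his | rfl | his
    · rw [gl i (by omega)]
      exact h.ncol i h0 (by omega) (fun h => hc ((hcl i his).2 h))
    · rw [gl i le_rfl]
      by_cases c1 : E (f (i - 1)) (f i)
      · have c2 : ¬ E (f (i + k + 1)) (f (i + k)) := fun c2 => hc (hcm.2 ⟨c1, c2⟩)
        rw [hf]
        exact h.ncol (i + k) (by omega) (by omega) (fun h => c2 h.2)
      · exact h.ncol i h0 (by omega) (fun h => c1 h.1)
    · rw [gr i (by omega)]
      exact h.ncol (i + k) (by omega) (by omega) (fun h => hc ((hcr i his).2 h))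
  · rw [gr _ (by omega)]
    congr 1; omega

lemma gm_no_reach (hE : Acyclic E) (hAB : Disjoint A B)
    (hd : DSepSet E A B S) {b : V} (hb : b ∈ B) {d : Bool} : ¬ GMReach E S A b d := by
  intro hr
  obtain ⟨n, f, hf, h0, hn, -, -⟩ := gm_reach_walk hE hr
  have hex : ∃ n, ∃ f, GMAct E S n f ∧ f 0 ∈ A ∧ f n ∈ B := ⟨n, f, hf, h0, hn ▸ hb⟩
  classical
  obtain ⟨f, hf, h0, hn⟩ := Nat.find_spec hex
  have hmin := fun m hm => Nat.find_min hex (m := m) hm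
  set n := Nat.find hex
  have hinj : ∀ s t, s < t → t ≤ n → f s ≠ f t := by
    intro s t hst htn he
    obtain ⟨g, hg, g0, g1⟩ := gm_shortcut hE hf hst htn he
    exact hmin (n - (t - s)) (by omega) ⟨g, hg, g0 ▸ h0, g1 ▸ hn⟩
  have hpos : 0 < n := by
    rcases Nat.eq_zero_or_pos n with h | h
    · rw [h] at hn; exact absurd hn (Set.disjoint_left.1 hAB h0)
    · exact h
  obtain ⟨t, t0, tn, ht⟩ := hd _ h0 _ hn n f ⟨hpos, rfl, rfl, by
    intro s hs t ht he
    rcases lt_trichotomy s t with h | h | h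
    · exact absurd he (hinj s t h ht)
    · exact h
    · exact absurd he.symm (hinj t s h hs), hf.adj⟩
  rcases ht with ⟨h1, h2⟩ | ⟨h1, h2, h3⟩
  · exact hf.ncol t t0 tn h1 h2
  · obtain ⟨s, hs, h⟩ := hf.col t t0 tn h1
    rcases Relation.reflTransGen_iff_eq_or_transGen.1 h with h | h
    · exact h2 (h ▸ hs)
    · exact h3 s h hs

lemma gm_reach_desc {w b : V} (h : Relation.ReflTransGen E w b) :
    ∀ d, ¬ GMAn E S w → GMReach E S A w d → ∃ d, GMReach E S A b d := by
  induction h using Relation.ReflTransGen.head_induction_on with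
  | refl => exact fun d _ h => ⟨d, h⟩
  | head hxy _ ih =>
    intro d hn hr
    have hx : _ ∉ S := fun h => hn (GMAn.self h)
    refine ih false (fun h => hn (h.head hxy)) ?_
    cases d
    · exact .downDown _ _ hr hx hxy
    · exact .upDown _ _ hr hx hxy

lemma gm_reach_anc {w a : V} (ha : a ∈ A) (h : Relation.ReflTransGen E w a) :
    ¬ GMAn E S w → GMReach E S A w true := by
  induction h using Relation.ReflTransGen.head_induction_on with
  | refl => exact fun _ => .start _ ha
  | head hxy _ ih =>
    intro hn
    exact .upUp _ _ (ih fun h => hn (h.head hxy)) (fun h => hn ((GMAn.self h).head hxy)) hxy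

/-- Moving against an edge from a vertex of the ancestral set. -/
lemma gm_reach_parent (hE : Acyclic E) (hAB : Disjoint A B) (hd : DSepSet E A B S)
    {w u : V} (hw : GMAn E (A ∪ B ∪ S) w) {d : Bool} (hr : GMReach E S A w d)
    (hS : d = true → w ∉ S) (huw : E u w) : GMReach E S A u true := by
  cases d with
  | true => exact .upUp _ _ hr (hS rfl) huw
  | false =>
    by_cases h : GMAn E S w
    · exact .downUp _ _ hr h huw
    · obtain ⟨s, (hs | hs) | hs, hws⟩ := hw
      · exact .upUp _ _ (gm_reach_anc hs hws h) (fun h' => h (GMAn.self h')) huw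
      · obtain ⟨d, hd'⟩ := gm_reach_desc hws _ h hr
        exact absurd hd' (gm_no_reach hE hAB hd hs)
      · exact absurd ⟨s, hs, hws⟩ h

lemma gm_reach_child {w u : V} {d : Bool} (hr : GMReach E S A w d) (hS : w ∉ S) (h : E w u) :
    GMReach E S A u false := by
  cases d
  · exact .downDown _ _ hr hS h
  · exact .upDown _ _ hr hS h

end Graph

/-- Global Markov property: under the Markov condition, d-separation implies conditional
independence for all pairwise disjoint sets `A`, `B`, `S` with `A`, `B` nonempty. -/
theorem stmt_9
    {V Ω Val : Type*} [Fintype V] [MeasurableSpace Ω] [StandardBorelSpace Ω]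
    [MeasurableSpace Val] [DiscreteMeasurableSpace Val] [Fintype Val] [Nonempty Val]
    (E : V → V → Prop) (hE : Acyclic E)
    (X : V → Ω → Val) (hX : ∀ v, Measurable (X v))
    (P : MeasureTheory.Measure Ω) [MeasureTheory.IsProbabilityMeasure P]
    (hMarkov : MarkovCondition E X hX P) :
    ∀ A B S : Set V, A.Nonempty → B.Nonempty →
      Disjoint A B → Disjoint A S → Disjoint B S →
      DSepSet E A B S → CondIndepFam X hX P S A B := by
  intro A B S _ _ hAB hAS hBS hd
  let W : Set V := {v | GMAn E (A ∪ B ∪ S) v}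
  let A' : Set V := {v | v ∈ W ∧ v ∉ S ∧ ∃ d, GMReach E S A v d}
  let B' : Set V := {v | v ∈ W ∧ v ∉ S ∧ ¬ ∃ d, GMReach E S A v d}
  have hW : A' ∪ B' ∪ S = W := by
    ext x
    constructor
    · rintro ((h | h) | h)
      · exact h.1
      · exact h.1
      · exact GMAn.self (Or.inr h)
    · intro h
      by_cases hS : x ∈ S
      · exact Or.inr hS
      · by_cases hr : ∃ d, GMReach E S A x d
        · exact Or.inl (Or.inl ⟨h, hS, hr⟩)
        · exact Or.inl (Or.inr ⟨h, hS, hr⟩)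
  have hsplit : GMSplit E A' B' S := by
    refine ⟨?_, fun v h h' => h'.2.2 h.2.2, fun v h => h.2.1, fun v h => h.2.1, ?_, ?_, ?_⟩
    · rw [hW]
      exact fun v hv u hu => GMAn.head hv hu
    · rintro a ⟨ha, haS, d, hr⟩ b hb hab
      exact hb.2.2 ⟨_, gm_reach_child hr haS hab⟩
    · rintro a ⟨ha, haS, d, hr⟩ b hb hab
      exact hb.2.2 ⟨_, gm_reach_parent hE hAB hd ha hr (fun _ => haS) hab⟩
    · rw [hW]
      rintro a ⟨ha, haS, d, hr⟩ b hb w hw haw hbw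
      exact hb.2.2 ⟨_, gm_reach_parent hE hAB hd hw (gm_reach_child hr haS haw) (by simp) hbw⟩
  refine gm_mono (gm_split hE hMarkov _ A' B' S hsplit rfl) ?_ ?_
  · intro a ha
    exact ⟨GMAn.self (Or.inl (Or.inl ha)), Set.disjoint_left.1 hAS ha, _, .start a ha⟩
  · intro b hb
    exact ⟨GMAn.self (Or.inl (Or.inr hb)), Set.disjoint_left.1 hBS hb,
      fun ⟨_, h⟩ => gm_no_reach hE hAB hd hb h⟩
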